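/- Strong converse for the maximum error probability: let W : 𝒳 → PMF(𝒴₁ × 𝒴₂) be a discrete memoryless broadcast channel, let ε₁, ε₂ ∈ (0,1), and let (R₂, R₁) be [ε₁,ε₂]-achievable with respect to the maximum error probability, i.e. for every δ > 0 there exist n(δ) ∈ ℕ and (M₁⁽ⁿ⁾, M₂⁽ⁿ⁾, n)-codes for all n ≥ n(δ) with (log M₁⁽ⁿ⁾)/n ≥ R₂ − δ, (log M₂⁽ⁿ⁾)/n ≥ R₁ − δ, λ₁⁽ⁿ⁾ ≤ ε₁ and λ₂⁽ⁿ⁾ ≤ ε₂. Then (R₂, R₁) belongs to the information region 𝒞 of W; consequently the [ε₁,ε₂]-capacity region for maximum error equals 𝒞 for all ε₁, ε₂ ∈ (0,1). -/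

import Mathlib

open scoped Classical BigOperators

noncomputable section

namespace BDBC

/-- A `(M₁, M₂, n)`-code for the bidirectional broadcast channel: an encoder at the
relay node and a decoder at each of the two receiving nodes (which know their own
message as side information); `none` plays the role of an erasure symbol. -/
structure Code (𝒳 𝒴₁ 𝒴₂ : Type) (M₁ M₂ n : ℕ) where
  enc : Fin M₁ × Fin M₂ → Fin n → 𝒳
  dec₁ : (Fin n → 𝒴₁) × Fin M₁ → Option (Fin M₂)
  dec₂ : (Fin n → 𝒴₂) × Fin M₂ → Option (Fin M₁)

variable {𝒳 𝒴₁ 𝒴₂ : Type}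

/-- Probability of the event `E` under the `n`-fold memoryless extension of the
broadcast channel `W` with input word `x`. -/
def prodProb [Fintype 𝒴₁] [Fintype 𝒴₂] (W : 𝒳 → PMF (𝒴₁ × 𝒴₂)) {n : ℕ}
    (x : Fin n → 𝒳) (E : (Fin n → 𝒴₁ × 𝒴₂) → Prop) : ℝ :=
  ∑ y ∈ Finset.univ.filter E, ∏ i, ((W (x i)) (y i)).toReal

/-- Error probability `λ₁(w₁,w₂)` at node 1 (which knows `w₁` and decodes `w₂`). -/
def err₁ [Fintype 𝒴₁] [Fintype 𝒴₂] (W : 𝒳 → PMF (𝒴₁ × 𝒴₂)) {M₁ M₂ n : ℕ}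
    (c : Code 𝒳 𝒴₁ 𝒴₂ M₁ M₂ n) (v : Fin M₁ × Fin M₂) : ℝ :=
  prodProb W (c.enc v) (fun y => c.dec₁ (fun i => (y i).1, v.1) ≠ some v.2)

/-- Error probability `λ₂(w₁,w₂)` at node 2 (which knows `w₂` and decodes `w₁`). -/
def err₂ [Fintype 𝒴₁] [Fintype 𝒴₂] (W : 𝒳 → PMF (𝒴₁ × 𝒴₂)) {M₁ M₂ n : ℕ}
    (c : Code 𝒳 𝒴₁ 𝒴₂ M₁ M₂ n) (v : Fin M₁ × Fin M₂) : ℝ :=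
  prodProb W (c.enc v) (fun y => c.dec₂ (fun i => (y i).2, v.2) ≠ some v.1)

/-- Maximum error probability at node `k`. -/
def maxErr₁ [Fintype 𝒴₁] [Fintype 𝒴₂] (W : 𝒳 → PMF (𝒴₁ × 𝒴₂)) {M₁ M₂ n : ℕ}
    (c : Code 𝒳 𝒴₁ 𝒴₂ M₁ M₂ n) : ℝ :=
  ⨆ v : Fin M₁ × Fin M₂, err₁ W c v

def maxErr₂ [Fintype 𝒴₁] [Fintype 𝒴₂] (W : 𝒳 → PMF (𝒴₁ × 𝒴₂)) {M₁ M₂ n : ℕ}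
    (c : Code 𝒳 𝒴₁ 𝒴₂ M₁ M₂ n) : ℝ :=
  ⨆ v : Fin M₁ × Fin M₂, err₂ W c v

/-- Average error probability at node `k`. -/
def avgErr₁ [Fintype 𝒴₁] [Fintype 𝒴₂] (W : 𝒳 → PMF (𝒴₁ × 𝒴₂)) {M₁ M₂ n : ℕ}
    (c : Code 𝒳 𝒴₁ 𝒴₂ M₁ M₂ n) : ℝ :=
  (∑ v : Fin M₁ × Fin M₂, err₁ W c v) / (M₁ * M₂)

def avgErr₂ [Fintype 𝒴₁] [Fintype 𝒴₂] (W : 𝒳 → PMF (𝒴₁ × 𝒴₂)) {M₁ M₂ n : ℕ}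
    (c : Code 𝒳 𝒴₁ 𝒴₂ M₁ M₂ n) : ℝ :=
  (∑ v : Fin M₁ × Fin M₂, err₂ W c v) / (M₁ * M₂)

/-- Shannon entropy (in nats) of a PMF on a finite type. -/
def pmfEntropy {α : Type} [Fintype α] (p : PMF α) : ℝ :=
  ∑ a : α, Real.negMulLog (p a).toReal

/-- Conditional mutual information `I(X;Y|U)` (in nats) computed from the joint law of
`(U, X, Y)` via `I(X;Y|U) = H(U,X) + H(U,Y) - H(U) - H(U,X,Y)`. -/
def condMI {U 𝒳' Y : Type} [Fintype U] [Fintype 𝒳'] [Fintype Y]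
    (p : PMF (U × 𝒳' × Y)) : ℝ :=
  pmfEntropy (p.map fun z => (z.1, z.2.1)) + pmfEntropy (p.map fun z => (z.1, z.2.2))
    - pmfEntropy (p.map Prod.fst) - pmfEntropy p

/-- Joint law of `(U, X, Y₁)` obtained by sampling `(u,x)` from `q` and `(y₁,y₂)` from `W x`. -/
def joint₁ {U : Type} (W : 𝒳 → PMF (𝒴₁ × 𝒴₂)) (q : PMF (U × 𝒳)) : PMF (U × 𝒳 × 𝒴₁) :=
  q.bind fun ux => (W ux.2).map fun y => (ux.1, ux.2, y.1)

/-- Joint law of `(U, X, Y₂)`. -/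
def joint₂ {U : Type} (W : 𝒳 → PMF (𝒴₁ × 𝒴₂)) (q : PMF (U × 𝒳)) : PMF (U × 𝒳 × 𝒴₂) :=
  q.bind fun ux => (W ux.2).map fun y => (ux.1, ux.2, y.2)

/-- The information region `𝒞` of the bidirectional broadcast channel `W`: pairs
`(R₂, R₁)` of nonnegative reals with `R₂ ≤ I(X;Y₂|U)` and `R₁ ≤ I(X;Y₁|U)` for some
finite auxiliary type `U` and input distribution `q` on `U × 𝒳`. -/
def infoRegion [Fintype 𝒳] [Fintype 𝒴₁] [Fintype 𝒴₂] (W : 𝒳 → PMF (𝒴₁ × 𝒴₂)) :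
    Set (ℝ × ℝ) :=
  {R | 0 ≤ R.1 ∧ 0 ≤ R.2 ∧
    ∃ (U : Type) (iU : Fintype U) (q : PMF (U × 𝒳)),
      haveI := iU
      R.1 ≤ condMI (joint₂ W q) ∧ R.2 ≤ condMI (joint₁ W q)}

section Converse

/-- Chernoff bound for a sum of independent bounded variables, written as finite sums. -/
lemma sum_prod_tail_le {𝒴 : Type} [Fintype 𝒴] {n : ℕ} (p g : Fin n → 𝒴 → ℝ)
    (hp : ∀ i y, 0 ≤ p i y) (hp1 : ∀ i, ∑ y, p i y = 1) {B s τ : ℝ}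
    (hg : ∀ i y, |g i y| ≤ B) (hs : 0 ≤ s) (hsB : s * B ≤ 1) :
    ∑ y ∈ Finset.univ.filter (fun y : Fin n → 𝒴 => τ ≤ ∑ i, g i (y i)), ∏ i, p i (y i)
      ≤ Real.exp (s * (∑ i, ∑ y, p i y * g i y - τ) + n * (s * B) ^ 2) := by
  have hpoint : ∀ i y, p i y * Real.exp (s * g i y)
      ≤ p i y + s * (p i y * g i y) + p i y * (s * B) ^ 2 := by
    intro i y
    have habs : |s * g i y| ≤ s * B := by
      rw [abs_mul, abs_of_nonneg hs]
      exact mul_le_mul_of_nonneg_left (hg i y) hs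
    have h := (abs_le.1 (Real.abs_exp_sub_one_sub_id_le (habs.trans hsB))).2
    have hsq : (s * g i y) ^ 2 ≤ (s * B) ^ 2 := sq_le_sq' (abs_le.1 habs).1 (abs_le.1 habs).2
    have := mul_le_mul_of_nonneg_left
      (show Real.exp (s * g i y) ≤ 1 + s * g i y + (s * B) ^ 2 by linarith) (hp i y)
    linarith
  have hletter : ∀ i, ∑ y, p i y * Real.exp (s * g i y)
      ≤ Real.exp (s * ∑ y, p i y * g i y + (s * B) ^ 2) := by
    intro i
    calc ∑ y, p i y * Real.exp (s * g i y)
        ≤ ∑ y, (p i y + s * (p i y * g i y) + p i y * (s * B) ^ 2) :=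
          Finset.sum_le_sum fun y _ => hpoint i y
      _ = s * ∑ y, p i y * g i y + (s * B) ^ 2 + 1 := by
          rw [Finset.sum_add_distrib, Finset.sum_add_distrib, ← Finset.mul_sum,
            ← Finset.sum_mul, hp1]
          ring
      _ ≤ _ := Real.add_one_le_exp _
  calc ∑ y ∈ Finset.univ.filter (fun y : Fin n → 𝒴 => τ ≤ ∑ i, g i (y i)), ∏ i, p i (y i)
      ≤ ∑ y ∈ Finset.univ.filter (fun y : Fin n → 𝒴 => τ ≤ ∑ i, g i (y i)),
          Real.exp (-(s * τ)) * ∏ i, (p i (y i) * Real.exp (s * g i (y i))) := by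
        refine Finset.sum_le_sum fun y hy => ?_
        have hτ := (Finset.mem_filter.1 hy).2
        rw [Finset.prod_mul_distrib, ← Real.exp_sum, ← Finset.mul_sum, mul_left_comm,
          ← Real.exp_add]
        refine le_mul_of_one_le_right (Finset.prod_nonneg fun i _ => hp i _) ?_
        have := mul_le_mul_of_nonneg_left hτ hs
        exact Real.one_le_exp (by linarith)
    _ ≤ ∑ y : Fin n → 𝒴,
          Real.exp (-(s * τ)) * ∏ i, (p i (y i) * Real.exp (s * g i (y i))) :=
        Finset.sum_le_univ_sum_of_nonneg fun y => mul_nonneg (Real.exp_pos _).le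
          (Finset.prod_nonneg fun i _ => mul_nonneg (hp i _) (Real.exp_pos _).le)
    _ = Real.exp (-(s * τ)) * ∏ i, ∑ y, p i y * Real.exp (s * g i y) := by
        rw [← Finset.mul_sum, Finset.prod_univ_sum, Fintype.piFinset_univ]
    _ ≤ Real.exp (-(s * τ)) * ∏ i, Real.exp (s * ∑ y, p i y * g i y + (s * B) ^ 2) := by
        refine mul_le_mul_of_nonneg_left (Finset.prod_le_prod (fun i _ => ?_)
          fun i _ => hletter i) (Real.exp_pos _).le
        exact Finset.sum_nonneg fun y _ => mul_nonneg (hp i y) (Real.exp_pos _).le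
    _ = _ := by
        rw [← Real.exp_sum, ← Real.exp_add, Finset.sum_add_distrib, ← Finset.mul_sum]
        congr 1
        simp
        ring

/-- Wolfowitz-type bound on the number of messages that can be decoded reliably when the
transition probabilities are dominated by `K` times a fixed law `q` outside small sets. -/
lemma card_mul_le_of_dominated {Ω ι : Type} [Fintype Ω] (S : Finset ι)
    (dec : Ω → Option ι) (p : ι → Ω → ℝ) (q : Ω → ℝ) (A : ι → Ω → Prop) {K ε β : ℝ}
    (hK : 0 ≤ K) (hp1 : ∀ j, ∑ ω, p j ω = 1) (hp : ∀ j ω, 0 ≤ p j ω)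
    (hq : ∀ ω, 0 ≤ q ω) (hq1 : ∑ ω, q ω = 1)
    (hdom : ∀ j ω, ¬ A j ω → p j ω ≤ K * q ω)
    (hA : ∀ j ∈ S, ∑ ω ∈ Finset.univ.filter (A j), p j ω ≤ β)
    (herr : ∀ j ∈ S, ∑ ω ∈ Finset.univ.filter (fun ω => dec ω ≠ some j), p j ω ≤ ε) :
    S.card * (1 - ε - β) ≤ K := by
  have hj : ∀ j ∈ S, 1 - ε - β ≤ ∑ ω, if dec ω = some j then K * q ω else 0 := by
    intro j hjS
    have hpt : ∀ ω, p j ω ≤ (if dec ω = some j then K * q ω else 0)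
        + (if A j ω then p j ω else 0) + (if dec ω ≠ some j then p j ω else 0) := by
      intro ω
      have h1 := hp j ω
      have h2 := mul_nonneg hK (hq ω)
      by_cases hd : dec ω = some j <;> by_cases ha : A j ω
      · simp [hd, ha]; linarith
      · simpa [hd, ha] using hdom j ω ha
      · simp [hd, ha]; linarith
      · simp [hd, ha]
    have hsum := Finset.sum_le_sum fun ω (_ : ω ∈ Finset.univ) => hpt ω
    rw [hp1, Finset.sum_add_distrib, Finset.sum_add_distrib, ← Finset.sum_filter (A j),
      ← Finset.sum_filter (fun ω => dec ω ≠ some j)] at hsum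
    linarith [hA j hjS, herr j hjS]
  calc (S.card : ℝ) * (1 - ε - β) = ∑ j ∈ S, (1 - ε - β) := by
        rw [Finset.sum_const, nsmul_eq_mul]
    _ ≤ ∑ j ∈ S, ∑ ω, if dec ω = some j then K * q ω else 0 := Finset.sum_le_sum hj
    _ = ∑ ω, ∑ j ∈ S, if dec ω = some j then K * q ω else 0 := Finset.sum_comm
    _ ≤ ∑ ω, K * q ω := by
        refine Finset.sum_le_sum fun ω _ => ?_
        have h2 := mul_nonneg hK (hq ω)
        cases hd : dec ω with
        | none => simpa using h2
        | some k =>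
          simp only [Option.some.injEq, Finset.sum_ite_eq]
          split_ifs
          · exact le_rfl
          · exact h2
    _ = K := by rw [← Finset.mul_sum, hq1, mul_one]

/-- Strong converse for codewords sharing the same divergence from a reference output law `Q`,
uniformly over the reference laws bounded below by `c`. -/
lemma exists_forall_card_le {𝒳 𝒴 : Type} [Fintype 𝒳] [Fintype 𝒴] (V : 𝒳 → 𝒴 → ℝ)
    (hV : ∀ a y, 0 ≤ V a y) (hV1 : ∀ a, ∑ y, V a y = 1) {c δ ε : ℝ} (hc : 0 < c)
    (hδ : 0 < δ) (hε : ε < 1) :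
    ∃ N : ℕ, ∀ n, N ≤ n → ∀ Q : 𝒴 → ℝ, (∀ y, c ≤ Q y) → ∑ y, Q y = 1 →
      ∀ (ι : Type) (S : Finset ι) (x : ι → Fin n → 𝒳) (dec : (Fin n → 𝒴) → Option ι) (m : ℝ),
        (∀ j ∈ S, ∑ i, ∑ y, V (x j i) y * (Real.log (V (x j i) y) - Real.log (Q y)) = m) →
        (∀ j ∈ S, ∑ y ∈ Finset.univ.filter (fun y => dec y ≠ some j),
          ∏ i, V (x j i) (y i) ≤ ε) →
        S.card * ((1 - ε) / 2) ≤ Real.exp (m + n * δ) := by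
  set L : ℝ := ∑ a, ∑ y, |Real.log (V a y)|
  have hVL : ∀ a y, |Real.log (V a y)| ≤ L := fun a y =>
    (Finset.single_le_sum (f := fun y => |Real.log (V a y)|) (fun _ _ => abs_nonneg _)
      (Finset.mem_univ y)).trans
    (Finset.single_le_sum (f := fun a => ∑ y, |Real.log (V a y)|)
      (fun _ _ => Finset.sum_nonneg fun _ _ => abs_nonneg _) (Finset.mem_univ a))
  have hL0 : 0 ≤ L := Finset.sum_nonneg fun _ _ => Finset.sum_nonneg fun _ _ => abs_nonneg _
  set B : ℝ := L + |Real.log c| + δ + 1 with hB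
  have hc0 := abs_nonneg (Real.log c)
  have hB0 : 0 < B := by linarith
  set s : ℝ := δ / (2 * B ^ 2) with hs
  have hs0 : 0 < s := by positivity
  have hsB : s * B ≤ 1 := by
    rw [hs, div_mul_eq_mul_div, div_le_one (by positivity)]
    nlinarith
  have hlim : Filter.Tendsto (fun n : ℕ => Real.exp (-(n * (δ ^ 2 / (4 * B ^ 2)))))
      Filter.atTop (nhds 0) :=
    Real.tendsto_exp_neg_atTop_nhds_zero.comp
      (tendsto_natCast_atTop_atTop.atTop_mul_const (by positivity))
  obtain ⟨N, hN⟩ := Filter.eventually_atTop.1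
    (hlim.eventually_le_const (show (0 : ℝ) < (1 - ε) / 2 by linarith))
  refine ⟨N, fun n hn Q hQc hQ1 ι S x dec m hm herr => ?_⟩
  have hQ0 : ∀ y, 0 < Q y := fun y => hc.trans_le (hQc y)
  have hQle : ∀ y, Q y ≤ 1 := fun y => hQ1 ▸
    Finset.single_le_sum (f := Q) (fun z _ => (hQ0 z).le) (Finset.mem_univ y)
  have hQlog : ∀ y, |Real.log (Q y)| ≤ |Real.log c| := by
    intro y
    have h1 := Real.log_le_log hc (hQc y)
    have h2 := Real.log_nonpos (hQ0 y).le (hQle y)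
    rw [abs_of_nonpos h2, abs_of_nonpos (h1.trans h2)]
    linarith
  have hg : ∀ a y, |Real.log (V a y) - Real.log (Q y)| ≤ B := fun a y => by
    have := abs_sub (Real.log (V a y)) (Real.log (Q y))
    linarith [hVL a y, hQlog y]
  have key := card_mul_le_of_dominated S dec (fun j y => ∏ i, V (x j i) (y i))
    (fun y => ∏ i, Q (y i))
    (fun j y => m + n * δ ≤ ∑ i, (Real.log (V (x j i) (y i)) - Real.log (Q (y i))))
    (K := Real.exp (m + n * δ)) (ε := ε) (β := (1 - ε) / 2) (Real.exp_pos _).le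
    (fun j => by
      have := Finset.prod_univ_sum (fun _ => Finset.univ) (fun (i : Fin n) y => V (x j i) y)
      rw [Fintype.piFinset_univ] at this
      rw [← this]
      simp [hV1])
    (fun j y => Finset.prod_nonneg fun i _ => hV _ _)
    (fun y => Finset.prod_nonneg fun i _ => (hQ0 _).le)
    (by
      have := Finset.prod_univ_sum (fun _ => Finset.univ) (fun (_ : Fin n) y => Q y)
      rw [Fintype.piFinset_univ] at this
      rw [← this]
      simp [hQ1])
    (fun j y hA => by
      by_cases h0 : ∃ i, V (x j i) (y i) = 0
      · obtain ⟨i, hi⟩ := h0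
        rw [Finset.prod_eq_zero (Finset.mem_univ i) hi]
        exact mul_nonneg (Real.exp_pos _).le (Finset.prod_nonneg fun i _ => (hQ0 _).le)
      · push Not at h0
        have hexp : ∏ i, V (x j i) (y i)
            = Real.exp (∑ i, (Real.log (V (x j i) (y i)) - Real.log (Q (y i))))
              * ∏ i, Q (y i) := by
          rw [Real.exp_sum, ← Finset.prod_mul_distrib]
          refine Finset.prod_congr rfl fun i _ => ?_
          rw [Real.exp_sub, Real.exp_log ((hV _ _).lt_of_ne' (h0 i)), Real.exp_log (hQ0 _),
            div_mul_cancel₀ _ (hQ0 _).ne']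
        rw [hexp]
        exact mul_le_mul_of_nonneg_right (Real.exp_le_exp.2 (not_le.1 hA).le)
          (Finset.prod_nonneg fun i _ => (hQ0 _).le))
    (fun j hj => by
      refine (sum_prod_tail_le (fun i => V (x j i))
        (fun i y => Real.log (V (x j i) y) - Real.log (Q y)) (fun i => hV _) (fun i => hV1 _)
        (fun i => hg _) hs0.le hsB).trans (le_trans (le_of_eq ?_) (hN n hn))
      rw [hm j hj, hs]
      congr 1
      field_simp
      ring)
    herr
  calc _ = S.card * (1 - ε - (1 - ε) / 2) := by ring
    _ ≤ _ := key

/-- Mutual information between the input and the output of the channel `V` with input law `P`. -/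
def inputMI {𝒳 𝒴 : Type} [Fintype 𝒳] [Fintype 𝒴] (V : 𝒳 → 𝒴 → ℝ) (P : 𝒳 → ℝ) : ℝ :=
  ∑ y, Real.negMulLog (∑ a, P a * V a y) - ∑ a, P a * ∑ y, Real.negMulLog (V a y)

lemma continuous_inputMI {𝒳 𝒴 : Type} [Fintype 𝒳] [Fintype 𝒴] (V : 𝒳 → 𝒴 → ℝ) :
    Continuous (inputMI V) := by
  unfold inputMI
  refine Continuous.sub (continuous_finsetSum _ fun y _ => Real.continuous_negMulLog.comp ?_) ?_
  <;> fun_prop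

/-- The average divergence from a slight perturbation of the output law exceeds the mutual
information by at most `δ`. -/
lemma sum_divergence_le_inputMI_add {𝒳 𝒴 : Type} [Fintype 𝒳] [Fintype 𝒴] {V : 𝒳 → 𝒴 → ℝ}
    (hV : ∀ a y, 0 ≤ V a y) (hV1 : ∀ a, ∑ y, V a y = 1) {P : 𝒳 → ℝ}
    (hP : P ∈ stdSimplex ℝ 𝒳) {δ κ : ℝ} (hκ : 0 ≤ κ) :
    ∑ a, P a * ∑ y, V a y * (Real.log (V a y)
        - Real.log (Real.exp (-δ) * ∑ b, P b * V b y + κ))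
      ≤ inputMI V P + δ := by
  set q : 𝒴 → ℝ := fun y => ∑ b, P b * V b y with hq
  have hq0 : ∀ y, 0 ≤ q y := fun y => Finset.sum_nonneg fun a _ => mul_nonneg (hP.1 a) (hV a y)
  have hq1 : ∑ y, q y = 1 := by
    simp only [hq]
    rw [Finset.sum_comm]
    simp only [← Finset.mul_sum, hV1, mul_one]
    exact hP.2
  have hexpand : ∑ a, P a * ∑ y, V a y * (Real.log (V a y)
        - Real.log (Real.exp (-δ) * q y + κ))
      = -(∑ a, P a * ∑ y, Real.negMulLog (V a y))
        - ∑ y, q y * Real.log (Real.exp (-δ) * q y + κ) := by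
    have h2 : ∑ y, q y * Real.log (Real.exp (-δ) * q y + κ)
        = ∑ a, P a * ∑ y, V a y * Real.log (Real.exp (-δ) * q y + κ) := by
      simp only [Finset.mul_sum]
      rw [Finset.sum_comm]
      refine Finset.sum_congr rfl fun y _ => ?_
      rw [hq, Finset.sum_mul]
      exact Finset.sum_congr rfl fun a _ => by ring
    rw [h2, ← Finset.sum_neg_distrib, ← Finset.sum_sub_distrib]
    refine Finset.sum_congr rfl fun a _ => ?_
    rw [← mul_neg, ← mul_sub, ← Finset.sum_neg_distrib, ← Finset.sum_sub_distrib]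
    congr 1
    refine Finset.sum_congr rfl fun y _ => ?_
    rw [Real.negMulLog]
    ring
  have hpt : ∀ y, -(q y * Real.log (Real.exp (-δ) * q y + κ))
      ≤ Real.negMulLog (q y) + q y * δ := by
    intro y
    rcases (hq0 y).eq_or_lt with h | h
    · simp [← h]
    · have h1 : Real.log (Real.exp (-δ) * q y) ≤ Real.log (Real.exp (-δ) * q y + κ) :=
        Real.log_le_log (by positivity) (by linarith)
      rw [Real.log_mul (Real.exp_pos _).ne' h.ne', Real.log_exp] at h1
      have := mul_le_mul_of_nonneg_left h1 h.le
      rw [Real.negMulLog]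
      linarith
  have hsum := Finset.sum_le_sum fun y (_ : y ∈ Finset.univ) => hpt y
  rw [Finset.sum_neg_distrib, Finset.sum_add_distrib, ← Finset.sum_mul, hq1] at hsum
  rw [hexpand, inputMI]
  linarith

/-- Number of occurrences of each letter in a word. -/
def letterCount {𝒳 : Type} {n : ℕ} (x : Fin n → 𝒳) (a : 𝒳) : Fin (n + 1) :=
  ⟨(Finset.univ.filter fun i => x i = a).card,
    Nat.lt_succ_of_le ((Finset.card_le_univ _).trans_eq (Fintype.card_fin n))⟩

/-- The empirical distribution attached to a vector of letter counts. -/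
def empirical {𝒳 : Type} {n : ℕ} (t : 𝒳 → Fin (n + 1)) (a : 𝒳) : ℝ := (t a : ℕ) / n

lemma sum_comp_eq_empirical {𝒳 : Type} [Fintype 𝒳] {n : ℕ} (hn : n ≠ 0) (x : Fin n → 𝒳)
    (F : 𝒳 → ℝ) : ∑ i, F (x i) = n * ∑ a, empirical (letterCount x) a * F a := by
  have hn' : (n : ℝ) ≠ 0 := Nat.cast_ne_zero.2 hn
  rw [← Finset.sum_fiberwise Finset.univ x, Finset.mul_sum]
  refine Finset.sum_congr rfl fun a _ => ?_
  rw [Finset.sum_congr rfl (g := fun _ => F a)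
    (fun i hi => by rw [(Finset.mem_filter.1 hi).2]), Finset.sum_const, nsmul_eq_mul]
  simp only [empirical, letterCount]
  field_simp

lemma empirical_letterCount_mem_stdSimplex {𝒳 : Type} [Fintype 𝒳] {n : ℕ} (hn : n ≠ 0)
    (x : Fin n → 𝒳) : empirical (letterCount x) ∈ stdSimplex ℝ 𝒳 := by
  refine ⟨fun a => by unfold empirical; positivity, ?_⟩
  have hn' : (n : ℝ) ≠ 0 := Nat.cast_ne_zero.2 hn
  have h := sum_comp_eq_empirical hn x fun _ => 1
  simp only [mul_one, Finset.sum_const, Finset.card_univ, Fintype.card_fin, nsmul_eq_mul] at h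
  exact mul_left_cancel₀ hn' (by rw [← h, mul_one])

/-- Strong converse for codes all of whose codewords have the same letter counts. -/
lemma exists_forall_card_le_inputMI {𝒳 𝒴 : Type} [Fintype 𝒳] [Fintype 𝒴] [Nonempty 𝒴]
    (V : 𝒳 → 𝒴 → ℝ) (hV : ∀ a y, 0 ≤ V a y) (hV1 : ∀ a, ∑ y, V a y = 1) {δ ε : ℝ}
    (hδ : 0 < δ) (hε : ε < 1) :
    ∃ N : ℕ, ∀ n, N ≤ n → n ≠ 0 → ∀ (ι : Type) (S : Finset ι) (x : ι → Fin n → 𝒳)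
      (dec : (Fin n → 𝒴) → Option ι) (t : 𝒳 → Fin (n + 1)),
        (∀ j ∈ S, letterCount (x j) = t) →
        (∀ j ∈ S, ∑ y ∈ Finset.univ.filter (fun y => dec y ≠ some j),
          ∏ i, V (x j i) (y i) ≤ ε) →
        S.card * ((1 - ε) / 2) ≤ Real.exp (n * (inputMI V (empirical t) + 2 * δ)) := by
  have hcard : (0 : ℝ) < Fintype.card 𝒴 := Nat.cast_pos.2 Fintype.card_pos
  have hexp : Real.exp (-δ) < 1 := by simpa using hδ
  set κ : ℝ := (1 - Real.exp (-δ)) / Fintype.card 𝒴 with hκ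
  have hκ0 : 0 < κ := div_pos (by linarith) hcard
  obtain ⟨N, hN⟩ := exists_forall_card_le V hV hV1 hκ0 hδ hε
  refine ⟨N, fun n hn hn0 ι S x dec t ht herr => ?_⟩
  rcases S.eq_empty_or_nonempty with rfl | ⟨j₀, hj₀⟩
  · simpa using (Real.exp_pos _).le
  have hP : empirical t ∈ stdSimplex ℝ 𝒳 :=
    ht j₀ hj₀ ▸ empirical_letterCount_mem_stdSimplex hn0 (x j₀)
  set Q : 𝒴 → ℝ := fun y => Real.exp (-δ) * ∑ b, empirical t b * V b y + κ with hQ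
  have hQc : ∀ y, κ ≤ Q y := fun y => le_add_of_nonneg_left <| mul_nonneg (Real.exp_pos _).le <|
    Finset.sum_nonneg fun b _ => mul_nonneg (hP.1 b) (hV b y)
  have hQ1 : ∑ y, Q y = 1 := by
    have h1 : ∑ y, ∑ b, empirical t b * V b y = 1 := by
      rw [Finset.sum_comm]
      simp only [← Finset.mul_sum, hV1, mul_one]
      exact hP.2
    simp only [hQ]
    rw [Finset.sum_add_distrib, ← Finset.mul_sum, h1, Finset.sum_const, Finset.card_univ,
      nsmul_eq_mul, hκ]
    field_simp
    ring
  refine (hN n hn Q hQc hQ1 ι S x dec _ (fun j hj => ?_) herr).trans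
    (Real.exp_le_exp.2 (?_ : n * (∑ a, empirical t a
      * ∑ y, V a y * (Real.log (V a y) - Real.log (Q y))) + _ ≤ _))
  · rw [sum_comp_eq_empirical hn0 (x j)
      (fun a => ∑ y, V a y * (Real.log (V a y) - Real.log (Q y))), ht j hj]
  · have := mul_le_mul_of_nonneg_left
      (sum_divergence_le_inputMI_add hV hV1 hP (δ := δ) hκ0.le) (Nat.cast_nonneg (α := ℝ) n)
    linarith

/-- Transition probabilities of the component `π` of the output of `W`. -/
def marginal {𝒳 𝒵 𝒴 : Type} (W : 𝒳 → PMF 𝒵) (π : 𝒵 → 𝒴) (a : 𝒳) (y : 𝒴) : ℝ :=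
  ((W a).map π y).toReal

lemma toReal_map_apply {α β : Type} [Fintype α] (p : PMF α) (f : α → β) (b : β) :
    (p.map f b).toReal = ∑ a ∈ Finset.univ.filter (fun a => f a = b), (p a).toReal := by
  rw [PMF.map_apply, tsum_fintype, ENNReal.toReal_sum, Finset.sum_filter]
  · refine Finset.sum_congr rfl fun a _ => ?_
    by_cases h : f a = b
    · simp [h]
    · simp [h, Ne.symm h]
  · intro a _
    split_ifs
    · exact p.apply_ne_top a
    · exact ENNReal.zero_ne_top

lemma sum_toReal {α : Type} [Fintype α] (p : PMF α) : ∑ a, (p a).toReal = 1 := by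
  rw [← ENNReal.toReal_sum fun a _ => p.apply_ne_top a, ← tsum_fintype (L := .unconditional _),
    p.tsum_coe, ENNReal.toReal_one]

/-- The law of the image of a product measure under a coordinatewise map. -/
lemma sum_prod_filter_comp {𝒵 𝒴 : Type} [Fintype 𝒵] [Fintype 𝒴] {n : ℕ}
    (p : Fin n → PMF 𝒵) (π : 𝒵 → 𝒴) (E : (Fin n → 𝒴) → Prop) :
    ∑ z ∈ Finset.univ.filter (fun z : Fin n → 𝒵 => E fun i => π (z i)),
        ∏ i, (p i (z i)).toReal
      = ∑ y ∈ Finset.univ.filter E, ∏ i, ((p i).map π (y i)).toReal := by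
  have hy : ∀ y : Fin n → 𝒴, ∏ i, ((p i).map π (y i)).toReal
      = ∑ z ∈ Finset.univ.filter (fun z : Fin n → 𝒵 => (fun i => π (z i)) = y),
          ∏ i, (p i (z i)).toReal := by
    intro y
    simp only [toReal_map_apply]
    rw [Finset.prod_univ_sum]
    refine Finset.sum_congr ?_ fun _ _ => rfl
    ext z
    simp [Fintype.mem_piFinset, funext_iff]
  simp only [hy]
  rw [← Finset.sum_fiberwise_of_maps_to (s := Finset.univ.filter _) (t := Finset.univ.filter E)
    (g := fun z : Fin n → 𝒵 => fun i => π (z i)) (fun z hz => by simpa using hz)]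
  refine Finset.sum_congr rfl fun y hyE => Finset.sum_congr ?_ fun _ _ => rfl
  ext z
  simp only [Finset.mem_filter, Finset.mem_univ, true_and] at hyE ⊢
  exact ⟨fun h => h.2, fun h => ⟨h ▸ hyE, h⟩⟩

lemma condMI_bind_map {𝒳 𝒵 𝒴 : Type} [Fintype 𝒳] [Fintype 𝒵] [Fintype 𝒴] (W : 𝒳 → PMF 𝒵)
    (π : 𝒵 → 𝒴) (P : PMF 𝒳) :
    condMI ((P.map fun a => ((), a)).bind fun ux => (W ux.2).map fun z => (ux.1, ux.2, π z))
      = inputMI (marginal W π) fun a => (P a).toReal := by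
  set r := (P.map fun a => ((), a)).bind fun ux => (W ux.2).map fun z => (ux.1, ux.2, π z)
    with hr
  have hr_apply : ∀ u a y, (r (u, a, y)).toReal = (P a).toReal * marginal W π a y := by
    intro u a y
    rw [hr, PMF.bind_map, PMF.bind_apply, tsum_eq_single a, ENNReal.toReal_mul]
    · simp only [Function.comp, marginal, toReal_map_apply]
      congr 1
      refine Finset.sum_congr ?_ fun _ _ => rfl
      ext z
      simp
    · intro b hb
      simp [PMF.map_apply, Ne.symm hb]
  have hV1 : ∀ a, ∑ y, marginal W π a y = 1 := fun a => sum_toReal _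
  have h1 : ∀ u a, (r.map (fun z => (z.1, z.2.1)) (u, a)).toReal = (P a).toReal := by
    intro u a
    rw [toReal_map_apply, Finset.sum_filter]
    simp [Fintype.sum_prod_type, hr_apply, ← Finset.mul_sum, hV1]
  have h2 : ∀ u y, (r.map (fun z => (z.1, z.2.2)) (u, y)).toReal
      = ∑ a, (P a).toReal * marginal W π a y := by
    intro u y
    rw [toReal_map_apply, Finset.sum_filter]
    simp [Fintype.sum_prod_type, hr_apply]
  have h3 : ∀ u, (r.map Prod.fst u).toReal = 1 := by
    intro u
    rw [← sum_toReal (r.map Prod.fst)]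
    simp
  simp only [condMI, pmfEntropy, inputMI, Fintype.sum_prod_type, h1, h2, h3, hr_apply]
  have h4 : ∀ a, ∑ y, Real.negMulLog ((P a).toReal * marginal W π a y)
      = Real.negMulLog (P a).toReal + (P a).toReal * ∑ y, Real.negMulLog (marginal W π a y) := by
    intro a
    simp only [Real.negMulLog_mul]
    rw [Finset.sum_add_distrib, ← Finset.sum_mul, ← Finset.mul_sum, hV1, one_mul]
  simp only [h4, Finset.sum_add_distrib]
  simp

lemma eventually_polynomial_le (d : ℕ) {A δ : ℝ} (hA : 0 < A) (hδ : 0 < δ) :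
    ∀ᶠ n : ℕ in Filter.atTop, ((n : ℝ) + 1) ^ d ≤ A * Real.exp (n * δ) := by
  have hto : Filter.Tendsto (fun n : ℕ => (n : ℝ) + 1) Filter.atTop Filter.atTop :=
    Filter.tendsto_atTop_add_const_right _ _ tendsto_natCast_atTop_atTop
  have h := (Real.tendsto_pow_mul_exp_neg_atTop_nhds_zero d).comp (hto.const_mul_atTop hδ)
  have hpos : 0 < A * Real.exp (-δ) * δ ^ d := by positivity
  filter_upwards [h.eventually_le_const hpos] with n hn
  simp only [Function.comp, mul_pow] at hn
  have hd : 0 < δ ^ d := by positivity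
  have h2 : ((n : ℝ) + 1) ^ d * Real.exp (-(δ * (n + 1))) ≤ A * Real.exp (-δ) := by
    refine le_of_mul_le_mul_left ?_ hd
    linarith
  calc ((n : ℝ) + 1) ^ d
      = ((n : ℝ) + 1) ^ d * Real.exp (-(δ * (n + 1))) * Real.exp (δ * (n + 1)) := by
        rw [mul_assoc, ← Real.exp_add]; simp
    _ ≤ A * Real.exp (-δ) * Real.exp (δ * (n + 1)) :=
        mul_le_mul_of_nonneg_right h2 (Real.exp_pos _).le
    _ = A * Real.exp (n * δ) := by
        rw [mul_assoc, ← Real.exp_add]; congr 2; ring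

/-- Rate bound obtained from the size `F` of a popular class among `M * M'` message pairs. -/
lemma rate_le_of_card {M M' F n : ℕ} {K A I δ R : ℝ} (hM : 1 ≤ M) (hM' : 1 ≤ M')
    (hn : n ≠ 0) (hK : 0 ≤ K) (hA : 0 < A) (hKA : K ≤ A * Real.exp (n * δ))
    (hF : (M * M' : ℝ) ≤ K * F) (hFA : F * A ≤ M * Real.exp (n * (I + 2 * δ)))
    (hR : R - δ ≤ Real.log M' / n) : R ≤ I + 4 * δ := by
  have hM0 : (0 : ℝ) < M := by exact_mod_cast hM
  have hM0' : (0 : ℝ) < M' := by exact_mod_cast hM'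
  have hn0 : (0 : ℝ) < n := Nat.cast_pos.2 (Nat.pos_of_ne_zero hn)
  have h1 : (M : ℝ) * A * M' ≤ M * A * Real.exp (n * (I + 3 * δ)) := by
    calc (M : ℝ) * A * M' = A * (M * M') := by ring
      _ ≤ A * (K * F) := mul_le_mul_of_nonneg_left hF hA.le
      _ = K * (F * A) := by ring
      _ ≤ K * (M * Real.exp (n * (I + 2 * δ))) := mul_le_mul_of_nonneg_left hFA hK
      _ ≤ A * Real.exp (n * δ) * (M * Real.exp (n * (I + 2 * δ))) :=
          mul_le_mul_of_nonneg_right hKA (by positivity)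
      _ = M * A * (Real.exp (n * δ) * Real.exp (n * (I + 2 * δ))) := by ring
      _ = M * A * Real.exp (n * (I + 3 * δ)) := by
          rw [← Real.exp_add]; congr 2; ring
  have h2 := (Real.log_le_iff_le_exp hM0').2 (le_of_mul_le_mul_left h1 (by positivity))
  have h3 : Real.log M' / n ≤ I + 3 * δ := by
    rw [div_le_iff₀ hn0]; linarith
  linarith

variable [Fintype 𝒴₁] [Fintype 𝒴₂]

lemma err₁_eq (W : 𝒳 → PMF (𝒴₁ × 𝒴₂)) {M₁ M₂ n : ℕ} (c : Code 𝒳 𝒴₁ 𝒴₂ M₁ M₂ n)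
    (w₁ : Fin M₁) (w₂ : Fin M₂) :
    err₁ W c (w₁, w₂) = ∑ y ∈ Finset.univ.filter (fun y => c.dec₁ (y, w₁) ≠ some w₂),
      ∏ i, marginal W Prod.fst (c.enc (w₁, w₂) i) (y i) := by
  unfold err₁ prodProb marginal
  convert sum_prod_filter_comp (fun i => W (c.enc (w₁, w₂) i)) Prod.fst
    fun y => c.dec₁ (y, w₁) ≠ some w₂

lemma err₂_eq (W : 𝒳 → PMF (𝒴₁ × 𝒴₂)) {M₁ M₂ n : ℕ} (c : Code 𝒳 𝒴₁ 𝒴₂ M₁ M₂ n)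
    (w₁ : Fin M₁) (w₂ : Fin M₂) :
    err₂ W c (w₁, w₂) = ∑ y ∈ Finset.univ.filter (fun y => c.dec₂ (y, w₂) ≠ some w₁),
      ∏ i, marginal W Prod.snd (c.enc (w₁, w₂) i) (y i) := by
  unfold err₂ prodProb marginal
  convert sum_prod_filter_comp (fun i => W (c.enc (w₁, w₂) i)) Prod.snd
    fun y => c.dec₂ (y, w₂) ≠ some w₁

/-- Some vector of letter counts is shared by at least a `1 / (n + 1) ^ |𝒳|` fraction of the
codewords. -/
lemma exists_popular_letterCount {𝒳 : Type} [Fintype 𝒳] {ι : Type} [Fintype ι] [Nonempty ι] {n : ℕ}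
    (x : ι → Fin n → 𝒳) :
    ∃ t, (∃ j, letterCount (x j) = t) ∧ (Fintype.card ι : ℝ) ≤ ((n : ℝ) + 1) ^ Fintype.card 𝒳
      * (Finset.univ.filter fun j => letterCount (x j) = t).card := by
  have hK : Fintype.card (𝒳 → Fin (n + 1)) = (n + 1) ^ Fintype.card 𝒳 := by simp
  obtain ⟨t, -, ht⟩ := Finset.exists_le_card_fiber_of_nsmul_le_card_of_maps_to
    (s := (Finset.univ : Finset ι)) (t := (Finset.univ : Finset (𝒳 → Fin (n + 1))))
    (f := fun j => letterCount (x j)) (b := (Fintype.card ι : ℝ) / ((n : ℝ) + 1) ^ Fintype.card 𝒳)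
    (fun _ _ => Finset.mem_univ _) Finset.univ_nonempty (by
      rw [nsmul_eq_mul, Finset.card_univ, hK, Finset.card_univ]
      push_cast
      rw [mul_div_cancel₀ _ (by positivity)])
  rw [div_le_iff₀' (by positivity)] at ht
  refine ⟨t, ?_, ht⟩
  by_contra! hne
  have h0 : (Finset.univ.filter fun j => letterCount (x j) = t).card = 0 := by
    simp [hne]
  rw [h0, Nat.cast_zero, mul_zero] at ht
  exact absurd ht (not_le.2 (Nat.cast_pos.2 Fintype.card_pos))

/-- Achievable rate pairs are, up to `4 * δ`, below the mutual informations of a common input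
law. -/
lemma exists_rates_le_inputMI_add [Fintype 𝒳] [Nonempty 𝒴₁] [Nonempty 𝒴₂]
    (W : 𝒳 → PMF (𝒴₁ × 𝒴₂)) {ε₁ ε₂ : ℝ} (hε₁ : ε₁ < 1) (hε₂ : ε₂ < 1) {R₂ R₁ δ : ℝ}
    (hδ : 0 < δ)
    (hach : ∃ N : ℕ, ∀ n, N ≤ n → ∃ (M₁ M₂ : ℕ) (c : Code 𝒳 𝒴₁ 𝒴₂ M₁ M₂ n),
      1 ≤ M₁ ∧ 1 ≤ M₂ ∧ R₂ - δ ≤ Real.log M₁ / n ∧ R₁ - δ ≤ Real.log M₂ / n ∧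
        (∀ v, err₁ W c v ≤ ε₁) ∧ (∀ v, err₂ W c v ≤ ε₂)) :
    ∃ P ∈ stdSimplex ℝ 𝒳, R₁ ≤ inputMI (marginal W Prod.fst) P + 4 * δ ∧
      R₂ ≤ inputMI (marginal W Prod.snd) P + 4 * δ := by
  obtain ⟨N, hN⟩ := hach
  obtain ⟨N₁, hN₁⟩ := exists_forall_card_le_inputMI (marginal W Prod.fst)
    (fun _ _ => ENNReal.toReal_nonneg) (fun _ => sum_toReal _) hδ hε₁
  obtain ⟨N₂, hN₂⟩ := exists_forall_card_le_inputMI (marginal W Prod.snd)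
    (fun _ _ => ENNReal.toReal_nonneg) (fun _ => sum_toReal _) hδ hε₂
  have hA₁ : 0 < (1 - ε₁) / 2 := by linarith
  have hA₂ : 0 < (1 - ε₂) / 2 := by linarith
  obtain ⟨n, hn, hn₁, hn₂, hn0, hK₁, hK₂⟩ := ((Filter.eventually_ge_atTop N).and
    ((Filter.eventually_ge_atTop N₁).and ((Filter.eventually_ge_atTop N₂).and
    ((Filter.eventually_ne_atTop 0).and
    ((eventually_polynomial_le (Fintype.card 𝒳) hA₁ hδ).and
    (eventually_polynomial_le (Fintype.card 𝒳) hA₂ hδ)))))).exists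
  obtain ⟨M₁, M₂, c, hM₁, hM₂, hR₂, hR₁, he₁, he₂⟩ := hN n hn
  have : Nonempty (Fin M₁ × Fin M₂) := ⟨(⟨0, hM₁⟩, ⟨0, hM₂⟩)⟩
  obtain ⟨t, ⟨v, hv⟩, ht⟩ := exists_popular_letterCount c.enc
  rw [Fintype.card_prod, Fintype.card_fin, Fintype.card_fin, Nat.cast_mul] at ht
  refine ⟨empirical t, hv ▸ empirical_letterCount_mem_stdSimplex hn0 _, ?_, ?_⟩
  · refine rate_le_of_card hM₁ hM₂ hn0 (by positivity) hA₁ hK₁ ht ?_ hR₁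
    have hw : ∀ w₁ : Fin M₁, ((Finset.univ.filter fun w₂ => letterCount (c.enc (w₁, w₂)) = t).card
        : ℝ) * ((1 - ε₁) / 2)
        ≤ Real.exp (n * (inputMI (marginal W Prod.fst) (empirical t) + 2 * δ)) := fun w₁ =>
      hN₁ n hn₁ hn0 _ _ (fun w₂ => c.enc (w₁, w₂)) (fun y => c.dec₁ (y, w₁)) t
        (fun j hj => (Finset.mem_filter.1 hj).2) fun j _ => by
          convert (err₁_eq W c w₁ j).symm.trans_le (he₁ (w₁, j))
    have hsum := Finset.sum_le_sum fun w₁ (_ : w₁ ∈ Finset.univ) => hw w₁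
    rw [← Finset.sum_mul, ← Nat.cast_sum, Finset.sum_const, Finset.card_univ, Fintype.card_fin,
      nsmul_eq_mul] at hsum
    convert hsum using 2
    congr 1
    simp only [Finset.card_filter, Fintype.sum_prod_type]
  · rw [mul_comm] at ht
    refine rate_le_of_card hM₂ hM₁ hn0 (by positivity) hA₂ hK₂ ht ?_ hR₂
    have hw : ∀ w₂ : Fin M₂, ((Finset.univ.filter fun w₁ => letterCount (c.enc (w₁, w₂)) = t).card
        : ℝ) * ((1 - ε₂) / 2)
        ≤ Real.exp (n * (inputMI (marginal W Prod.snd) (empirical t) + 2 * δ)) := fun w₂ =>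
      hN₂ n hn₂ hn0 _ _ (fun w₁ => c.enc (w₁, w₂)) (fun y => c.dec₂ (y, w₂)) t
        (fun j hj => (Finset.mem_filter.1 hj).2) fun j _ => by
          convert (err₂_eq W c j w₂).symm.trans_le (he₂ (j, w₂))
    have hsum := Finset.sum_le_sum fun w₂ (_ : w₂ ∈ Finset.univ) => hw w₂
    rw [← Finset.sum_mul, ← Nat.cast_sum, Finset.sum_const, Finset.card_univ, Fintype.card_fin,
      nsmul_eq_mul] at hsum
    convert hsum using 2
    congr 1
    simp only [Finset.card_filter, Fintype.sum_prod_type_right]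

end Converse

/-- **Strong converse for the maximum error probability**: for every `ε₁, ε₂ ∈ (0,1)`,
any `[ε₁,ε₂]`-achievable rate pair (with respect to maximum error probability) lies in
the information region `𝒞`; consequently the `[ε₁,ε₂]`-capacity region for maximum
error equals `𝒞` for all `ε₁, ε₂ ∈ (0,1)`. -/
theorem strongConverseMaxError [Fintype 𝒳] [Nonempty 𝒳] [Fintype 𝒴₁] [Nonempty 𝒴₁]
    [Fintype 𝒴₂] [Nonempty 𝒴₂]
    (W : 𝒳 → PMF (𝒴₁ × 𝒴₂)) (ε₁ ε₂ : ℝ)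
    (hε₁ : ε₁ ∈ Set.Ioo (0 : ℝ) 1) (hε₂ : ε₂ ∈ Set.Ioo (0 : ℝ) 1)
    (R₂ R₁ : ℝ) (hR₂ : 0 ≤ R₂) (hR₁ : 0 ≤ R₁)
    (hach : ∀ δ : ℝ, 0 < δ → ∃ N : ℕ, ∀ n, N ≤ n →
      ∃ (M₁ M₂ : ℕ) (c : Code 𝒳 𝒴₁ 𝒴₂ M₁ M₂ n),
        1 ≤ M₁ ∧ 1 ≤ M₂ ∧
        R₂ - δ ≤ Real.log M₁ / n ∧ R₁ - δ ≤ Real.log M₂ / n ∧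
        (∀ v, err₁ W c v ≤ ε₁) ∧ (∀ v, err₂ W c v ≤ ε₂)) :
    (R₂, R₁) ∈ infoRegion W := by
  set G : (𝒳 → ℝ) → ℝ := fun P => min (inputMI (marginal W Prod.fst) P - R₁)
    (inputMI (marginal W Prod.snd) P - R₂) with hG
  have hGc : Continuous G := ((continuous_inputMI _).sub continuous_const).min
    ((continuous_inputMI _).sub continuous_const)
  have happrox : ∀ δ : ℝ, 0 < δ → ∃ P ∈ stdSimplex ℝ 𝒳, -(4 * δ) ≤ G P := by
    intro δ hδ
    obtain ⟨P, hP, h₁, h₂⟩ := exists_rates_le_inputMI_add W hε₁.2 hε₂.2 hδ (hach δ hδ)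
    exact ⟨P, hP, le_min (by linarith) (by linarith)⟩
  obtain ⟨P₀, hP₀, -⟩ := happrox 1 one_pos
  obtain ⟨P, hP, hmax⟩ :=
    (isCompact_stdSimplex ℝ 𝒳).exists_isMaxOn ⟨P₀, hP₀⟩ hGc.continuousOn
  have hGP : 0 ≤ G P := by
    by_contra! hneg
    obtain ⟨P', hP', h'⟩ := happrox (-G P / 8) (by linarith)
    have := hmax hP'
    simp only [Set.mem_ofPred_eq] at this
    linarith
  have hGP₁ := hGP.trans (min_le_left _ _)
  have hGP₂ := hGP.trans (min_le_right _ _)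
  let p : PMF 𝒳 := PMF.ofFintype (fun a => ENNReal.ofReal (P a)) (by
    rw [← ENNReal.ofReal_sum_of_nonneg fun a _ => hP.1 a, hP.2, ENNReal.ofReal_one])
  have hp : (fun a => (p a).toReal) = P := funext fun a => by
    simp [p, ENNReal.toReal_ofReal (hP.1 a)]
  refine ⟨hR₂, hR₁, Unit, inferInstance, p.map fun a => ((), a), ?_, ?_⟩
  · rw [joint₂, condMI_bind_map W Prod.snd p, hp]
    linarith
  · rw [joint₁, condMI_bind_map W Prod.fst p, hp]
    linarith

end BDBC
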